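/- Fix z ∈ V and let (s_k) be the closed chain with z-recurrent decompositions s_k = ρ_k + m_k·δ_z + Δv_k. Then for every k ≥ 1: (a) ρ_k = â_{i_k} ρ_{k−1}, so the process (ρ_k) follows the open chain; (b) m_k = m_0 + Σ_{j=1}^k av_{i_j→z}(ρ_j); and (c) the threshold time satisfies τ = min{ k ≥ 0 : m_k ≥ 0 }. -/

import Mathlib

open scoped BigOperators
open Classical Filter

noncomputable section

namespace ThresholdState

variable {V : Type*} [Fintype V] [DecidableEq V]

/-- `A i j` is the number of directed edges from `i` to `j`. -/
def outdeg (A : V → V → ℕ) (i : V) : ℕ := ∑ j, A i j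

def indeg (A : V → V → ℕ) (i : V) : ℕ := ∑ j, A j i

/-- Eulerian: out-degree equals in-degree at every vertex. -/
def Eulerian (A : V → V → ℕ) : Prop := ∀ i, outdeg A i = indeg A i

/-- (Strongly) connected multigraph. -/
def Connected (A : V → V → ℕ) : Prop :=
  ∀ i j : V, Relation.ReflTransGen (fun a b => 0 < A a b) i j

def deg (A : V → V → ℕ) (i : V) : ℕ := outdeg A i

/-- Graph Laplacian: `Δu(i) = -deg(i)·u(i) + Σ_{e incoming to i} u(e⁻)`. -/
def lap (A : V → V → ℕ) (u : V → ℤ) (i : V) : ℤ :=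
  -(deg A i : ℤ) * u i + ∑ j, (A j i : ℤ) * u j

def delta (z : V) : V → ℤ := fun j => if j = z then 1 else 0

/-- Toppling vertex `i`: replace `s` by `s + Δδ_i`. -/
def toppleAt (A : V → V → ℕ) (s : V → ℤ) (i : V) : V → ℤ :=
  fun j => s j + lap A (delta i) j

def applySeq (A : V → V → ℕ) (s : V → ℤ) (l : List V) : V → ℤ :=
  l.foldl (toppleAt A) s

/-- A legal toppling sequence (avoiding the forbidden set `F`): each toppled
vertex is unstable when toppled and does not lie in `F`. -/
def ValidSeq (A : V → V → ℕ) (F : V → Prop) : (V → ℤ) → List V → Prop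
  | _, [] => True
  | s, i :: l => ¬ F i ∧ (deg A i : ℤ) ≤ s i ∧ ValidSeq A F (toppleAt A s i) l

/-- Stable at every non-forbidden vertex. -/
def StableOff (A : V → V → ℕ) (F : V → Prop) (s : V → ℤ) : Prop :=
  ∀ i, ¬ F i → s i ≤ (deg A i : ℤ) - 1

def StabilizesTo (A : V → V → ℕ) (F : V → Prop) (s : V → ℤ) (l : List V) : Prop :=
  ValidSeq A F s l ∧ StableOff A F (applySeq A s l)

def StabilizableVia (A : V → V → ℕ) (F : V → Prop) (s : V → ℤ) : Prop :=
  ∃ l, StabilizesTo A F s l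

/-- Stabilizable with no forbidden vertices. -/
def Stabilizable (A : V → V → ℕ) (s : V → ℤ) : Prop :=
  StabilizableVia A (fun _ => False) s

def stabSeq (A : V → V → ℕ) (F : V → Prop) (s : V → ℤ) : List V :=
  if h : StabilizableVia A F s then h.choose else []

def stabilizeVia (A : V → V → ℕ) (F : V → Prop) (s : V → ℤ) : V → ℤ :=
  applySeq A s (stabSeq A F s)

/-- Odometer: number of topplings at each vertex (`0` everywhere if not stabilizable). -/
def odometerVia (A : V → V → ℕ) (F : V → Prop) (s : V → ℤ) : V → ℕ :=
  fun i => (stabSeq A F s).count i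

def sinkStabilize (A : V → V → ℕ) (z : V) (s : V → ℤ) : V → ℤ :=
  stabilizeVia A (fun i => i = z) s

def sinkOdometer (A : V → V → ℕ) (z : V) (s : V → ℤ) : V → ℕ :=
  odometerVia A (fun i => i = z) s

/-- `ρ` is `z`-recurrent (Dhar's burning test): `ρ(z) = deg z`, `ρ(i) ≤ deg i - 1`
off the sink, and every site other than `z` topples exactly once in the
stabilization of `ρ + Δδ_z` with sink `z`. -/
def ZRec (A : V → V → ℕ) (z : V) (ρ : V → ℤ) : Prop :=
  ρ z = (deg A z : ℤ) ∧ (∀ i, i ≠ z → ρ i ≤ (deg A i : ℤ) - 1) ∧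
  ∃ l : List V, StabilizesTo A (fun i => i = z) (fun j => ρ j + lap A (delta z) j) l ∧
    ∀ i, i ≠ z → l.count i = 1

/-- `κ` = number of `z`-recurrent sandpiles. -/
def kappa (A : V → V → ℕ) (z : V) : ℕ := Nat.card {ρ : V → ℤ // ZRec A z ρ}

def totalMass (s : V → ℤ) : ℤ := ∑ i, s i

/-- Open addition operator `â_i` (with sink `z`). -/
def openAdd (A : V → V → ℕ) (z i : V) (ρ : V → ℤ) : V → ℤ :=
  fun j => if j = z then (deg A z : ℤ) else sinkStabilize A z (fun k => ρ k + delta i k) j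

/-- `â_i⁻¹` on `Rec(z)`. -/
def openAddInv (A : V → V → ℕ) (z i : V) (ρ : V → ℤ) : V → ℤ :=
  if h : ∃ ρ', ZRec A z ρ' ∧ openAdd A z i ρ' = ρ then h.choose else ρ

/-- Burst size `av_{i→z}(ρ) = |â_i⁻¹ρ| - |ρ| + 1`. -/
def burst (A : V → V → ℕ) (z i : V) (ρ : V → ℤ) : ℤ :=
  totalMass (openAddInv A z i ρ) - totalMass ρ + 1

/-- The `z`-recurrent decomposition `s = ρ + m·δ_z + Δv` with `ρ ∈ Rec(z)`, `v(z)=0`. -/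
def ZDecomp (A : V → V → ℕ) (z : V) (s ρ : V → ℤ) (m : ℤ) (v : V → ℤ) : Prop :=
  ZRec A z ρ ∧ v z = 0 ∧ ∀ j, s j = ρ j + m * delta z j + lap A v j

/-- `R_z(s)`: the `z`-recurrent representative of `s`. -/
def Rz (A : V → V → ℕ) (z : V) (s : V → ℤ) : V → ℤ :=
  if h : ∃ ρ, ∃ m, ∃ v, ZDecomp A z s ρ m v then h.choose else s

/-- `m_z(s)`: the integer in the `z`-recurrent decomposition of `s`. -/
def mz (A : V → V → ℕ) (z : V) (s : V → ℤ) : ℤ :=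
  if h : ∃ m, ∃ ρ, ∃ v, ZDecomp A z s ρ m v then h.choose else 0

/-- Closed addition operator `a_i`. -/
def closedAdd (A : V → V → ℕ) (i : V) (s : V → ℤ) : V → ℤ :=
  if Stabilizable A (fun j => s j + delta i j) then
    stabilizeVia A (fun _ => False) (fun j => s j + delta i j)
  else fun j => s j + delta i j

/-- The closed chain after making the additions listed in `w` (in order). -/
def chain (A : V → V → ℕ) (s0 : V → ℤ) (w : List V) : V → ℤ :=
  w.foldl (fun s i => closedAdd A i s) s0

/-- `w` is a threshold word for `s0`: the chain first becomes non-stabilizable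
exactly after the additions in `w`, i.e. `τ = |w|` on the cylinder of `w`. -/
def IsThresholdWord (A : V → V → ℕ) (s0 : V → ℤ) (w : List V) : Prop :=
  ¬ Stabilizable A (chain A s0 w) ∧
  ∀ w' : List V, w' <+: w → w' ≠ w → Stabilizable A (chain A s0 w')

def wordProb (α : V → ℝ) (w : List V) : ℝ := (w.map α).prod

/-- `P_{s0}(E at the threshold time)`: total probability of the (disjoint)
cylinders of threshold words satisfying `E`. -/
def thresholdProb (A : V → V → ℕ) (α : V → ℝ) (s0 : V → ℤ) (E : List V → Prop) : ℝ :=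
  ∑' w : List V, if IsThresholdWord A s0 w ∧ E w then wordProb α w else 0

/-- `E_{s0}[f at the threshold time]`. -/
def thresholdExp (A : V → V → ℕ) (α : V → ℝ) (s0 : V → ℤ) (f : List V → ℝ) : ℝ :=
  ∑' w : List V, if IsThresholdWord A s0 w then wordProb α w * f w else 0

end ThresholdState

namespace ThresholdState

variable {V : Type*}

lemma lap_add [Fintype V] (A : V → V → ℕ) (u v : V → ℤ) : lap A (u + v) = lap A u + lap A v := by
  funext i
  simp only [lap, Pi.add_apply, mul_add, Finset.sum_add_distrib]
  ring

lemma lap_neg [Fintype V] (A : V → V → ℕ) (u : V → ℤ) : lap A (-u) = -lap A u := by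
  funext i
  simp only [lap, Pi.neg_apply, mul_neg, Finset.sum_neg_distrib]
  ring

lemma lap_sub [Fintype V] (A : V → V → ℕ) (u v : V → ℤ) : lap A (u - v) = lap A u - lap A v := by
  rw [sub_eq_add_neg, lap_add, lap_neg, sub_eq_add_neg]

lemma lap_zero [Fintype V] (A : V → V → ℕ) : lap A 0 = 0 := by
  funext i
  simp [lap]

lemma lap_smul [Fintype V] (A : V → V → ℕ) (c : ℤ) (u : V → ℤ) : lap A (c • u) = c • lap A u := by
  funext i
  simp only [lap, Pi.smul_apply, smul_eq_mul, mul_add, Finset.mul_sum]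
  congr 1
  · ring
  · exact Finset.sum_congr rfl fun j _ => by ring

lemma delta_nonneg [DecidableEq V] (z j : V) : 0 ≤ delta z j := by
  unfold delta
  split_ifs <;> simp

lemma delta_self [DecidableEq V] (z : V) : delta z z = 1 := by simp [delta]

lemma delta_of_ne [DecidableEq V] {z j : V} (h : j ≠ z) : delta z j = 0 := by simp [delta, h]

lemma lap_eq_sum_sub [Fintype V] {A : V → V → ℕ} (hA : Eulerian A) (u : V → ℤ) (i : V) :
    lap A u i = ∑ j, (A j i : ℤ) * (u j - u i) := by
  have h : (deg A i : ℤ) = ∑ j, (A j i : ℤ) := by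
    rw [deg, hA i, indeg]
    push_cast
    rfl
  simp only [lap, h, mul_sub, Finset.sum_sub_distrib, ← Finset.sum_mul]
  ring

lemma lap_const [Fintype V] {A : V → V → ℕ} (hA : Eulerian A) (c : ℤ) : lap A (fun _ => c) = 0 := by
  funext i
  simp [lap_eq_sum_sub hA]

lemma lap_nonneg_of_isMin [Fintype V] {A : V → V → ℕ} (hA : Eulerian A) {u : V → ℤ} {i : V}
    (h : ∀ j, u i ≤ u j) : 0 ≤ lap A u i := by
  rw [lap_eq_sum_sub hA]
  exact Finset.sum_nonneg fun j _ => mul_nonneg (by positivity) (sub_nonneg.2 (h j))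

lemma sum_lap [Fintype V] (A : V → V → ℕ) (u : V → ℤ) : ∑ i, lap A u i = 0 := by
  simp only [lap, Finset.sum_add_distrib, deg, outdeg]
  rw [Finset.sum_comm (f := fun i j => (A j i : ℤ) * u j), ← Finset.sum_add_distrib]
  refine Finset.sum_eq_zero fun i _ => ?_
  rw [← Finset.sum_mul]
  push_cast
  ring

lemma toppleAt_eq [Fintype V] [DecidableEq V] (A : V → V → ℕ) (s : V → ℤ) (i : V) :
    toppleAt A s i = s + lap A (delta i) := rfl

/-- The toppling counts of a sequence, as an integer-valued function. -/
def counts [DecidableEq V] (l : List V) : V → ℤ := fun i => (l.count i : ℤ)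

lemma counts_cons [DecidableEq V] (i : V) (l : List V) : counts (i :: l) = delta i + counts l := by
  funext j
  by_cases h : j = i
  · subst h
    simp [counts, delta, add_comm]
  · simp [counts, delta, h, Ne.symm h]

lemma counts_nonneg [DecidableEq V] (l : List V) (i : V) : 0 ≤ counts l i := Int.natCast_nonneg _

lemma applySeq_eq [Fintype V] [DecidableEq V] (A : V → V → ℕ) (l : List V) (s : V → ℤ) :
    applySeq A s l = s + lap A (counts l) := by
  induction l generalizing s with
  | nil =>
    have : counts ([] : List V) = 0 := by funext j; simp [counts]
    simp [applySeq, this, lap_zero]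
  | cons i l ih =>
    have : applySeq A s (i :: l) = applySeq A (toppleAt A s i) l := rfl
    rw [this, ih, toppleAt_eq, counts_cons, lap_add, add_assoc]

lemma one_le_of_unstable [Fintype V] {A : V → V → ℕ} {s u : V → ℤ} {i : V} (hu : ∀ j, 0 ≤ u j)
    (hi : (deg A i : ℤ) ≤ s i) (hs : (s + lap A u) i ≤ (deg A i : ℤ) - 1) : 1 ≤ u i := by
  by_contra! h
  have h0 : u i = 0 := le_antisymm (by lia) (hu i)
  have : 0 ≤ lap A u i := by
    rw [lap, h0, mul_zero, zero_add]
    exact Finset.sum_nonneg fun j _ => mul_nonneg (by positivity) (hu j)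
  simp only [Pi.add_apply] at hs
  lia

lemma sub_delta_nonneg [DecidableEq V]
    {u : V → ℤ} (hu : ∀ j, 0 ≤ u j) {i : V} (hi : 1 ≤ u i) (j : V) :
    0 ≤ (u - delta i) j := by
  by_cases h : j = i
  · subst h
    simpa [delta] using hi
  · simpa [delta, h] using hu j

lemma toppleAt_add_lap_sub [Fintype V] [DecidableEq V] (A : V → V → ℕ) (s u : V → ℤ) (i : V) :
    toppleAt A s i + lap A (u - delta i) = s + lap A u := by
  rw [toppleAt_eq, lap_sub]
  abel

/-- Least action principle. -/
lemma counts_le_of_stableOff [Fintype V] [DecidableEq V]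
    {A : V → V → ℕ} {F : V → Prop} {l : List V} {s u : V → ℤ}
    (hl : ValidSeq A F s l) (hu : ∀ j, 0 ≤ u j) (hs : StableOff A F (s + lap A u)) (j : V) :
    counts l j ≤ u j := by
  induction l generalizing s u with
  | nil => simpa [counts] using hu j
  | cons i l ih =>
    obtain ⟨hF, hi, hl⟩ := hl
    have h1 := one_le_of_unstable hu hi (hs i hF)
    have := ih hl (sub_delta_nonneg hu h1) (by rwa [toppleAt_add_lap_sub])
    rw [counts_cons]
    simp only [Pi.add_apply, Pi.sub_apply] at this ⊢
    lia

lemma stabilizableVia_of_stableOff [Fintype V] [DecidableEq V]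
    {A : V → V → ℕ} {F : V → Prop} {s u : V → ℤ}
    (hu : ∀ j, 0 ≤ u j) (hs : StableOff A F (s + lap A u)) : StabilizableVia A F s := by
  obtain ⟨n, hn⟩ : ∃ n : ℕ, ∑ j, u j ≤ n := ⟨_, Int.self_le_toNat _⟩
  induction n generalizing s u with
  | zero =>
    have h0 : u = 0 := by
      funext j
      exact (Finset.sum_eq_zero_iff_of_nonneg fun j _ => hu j).1
        (le_antisymm (by simpa using hn) (Finset.sum_nonneg fun j _ => hu j)) j (Finset.mem_univ j)
    rw [h0, lap_zero, add_zero] at hs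
    exact ⟨[], trivial, hs⟩
  | succ n ih =>
    by_cases hst : StableOff A F s
    · exact ⟨[], trivial, hst⟩
    simp only [StableOff, not_forall] at hst
    obtain ⟨i, hF, hi⟩ := hst
    have hi' : (deg A i : ℤ) ≤ s i := by lia
    have h1 := one_le_of_unstable hu hi' (hs i hF)
    have hsum : ∑ j, delta i j = 1 := by simp [delta]
    obtain ⟨l, hl, hl'⟩ := ih (s := toppleAt A s i) (sub_delta_nonneg hu h1)
      (by rwa [toppleAt_add_lap_sub]) (by
        simp only [Pi.sub_apply, Finset.sum_sub_distrib, hsum]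
        push_cast at hn
        lia)
    exact ⟨i :: l, ⟨hF, hi', hl⟩, hl'⟩

lemma stabilizable_iff [Fintype V] [DecidableEq V] {A : V → V → ℕ} (hA : Eulerian A) (s : V → ℤ) :
    Stabilizable A s ↔ ∃ u : V → ℤ, ∀ i, (s + lap A u) i ≤ (deg A i : ℤ) - 1 := by
  constructor
  · rintro ⟨l, -, hl⟩
    refine ⟨counts l, fun i => ?_⟩
    rw [← applySeq_eq]
    exact hl i not_false
  · rintro ⟨u, hu⟩
    obtain ⟨c, hc⟩ := (Set.finite_range u).bddBelow
    refine stabilizableVia_of_stableOff (u := u - fun _ => c)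
      (fun j => sub_nonneg.2 (hc ⟨j, rfl⟩)) fun i _ => ?_
    rw [lap_sub, lap_const hA, sub_zero]
    exact hu i

lemma stabilizeVia_spec [Fintype V] [DecidableEq V] {A : V → V → ℕ} {F : V → Prop} {s : V → ℤ}
    (h : StabilizableVia A F s) :
    ∃ l, ValidSeq A F s l ∧ stabilizeVia A F s = s + lap A (counts l) ∧
      StableOff A F (s + lap A (counts l)) := by
  refine ⟨h.choose, h.choose_spec.1, ?_, ?_⟩
  · rw [← applySeq_eq, stabilizeVia, stabSeq, dif_pos h]
  · rw [← applySeq_eq]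
    exact h.choose_spec.2

lemma counts_eq_zero_of_forbidden [Fintype V] [DecidableEq V]
    {A : V → V → ℕ} {F : V → Prop} {l : List V} {s : V → ℤ}
    (hl : ValidSeq A F s l) {z : V} (hz : F z) : counts l z = 0 := by
  induction l generalizing s with
  | nil => simp [counts]
  | cons i l ih =>
    obtain ⟨hF, -, hl⟩ := hl
    have : z ≠ i := fun h => hF (h ▸ hz)
    simp [counts_cons, ih hl, delta_of_ne this]

/-- A rank function on vertices that decreases along some incoming edge away from `z`. -/
lemma exists_rank {A : V → V → ℕ} (hC : Connected A) (z : V) :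
    ∃ d : V → ℕ, ∀ i, i ≠ z → ∃ j, 0 < A j i ∧ d j < d i := by
  let R : ℕ → Set V := fun n => Nat.rec {z} (fun _ S => {i | ∃ j ∈ S, 0 < A j i}) n
  have hR : ∀ i, ∃ n, i ∈ R n := by
    intro i
    induction hC z i with
    | refl => exact ⟨0, rfl⟩
    | tail _ h ih =>
      obtain ⟨n, hn⟩ := ih
      exact ⟨n + 1, _, hn, h⟩
  have hmin : ∀ i, ∃ n, i ∈ R n ∧ ∀ m, i ∈ R m → n ≤ m := fun i =>
    ⟨sInf {n | i ∈ R n}, Nat.sInf_mem (hR i), fun _ hm => Nat.sInf_le hm⟩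
  choose d hd hle using hmin
  refine ⟨d, fun i hi => ?_⟩
  have hmem := hd i
  rcases hn : d i with _ | n
  · rw [hn] at hmem
    exact absurd hmem hi
  · rw [hn] at hmem
    obtain ⟨j, hj, hA⟩ := hmem
    exact ⟨j, hA, Nat.lt_succ_of_le (hle j n hj)⟩

/-- A strictly superharmonic function off `z`. -/
lemma exists_lap_le_neg_one [Fintype V] [DecidableEq V]
    {A : V → V → ℕ} (hA : Eulerian A) (hC : Connected A) (z : V) :
    ∃ h : V → ℤ, h z = 0 ∧ ∀ i, i ≠ z → lap A h i ≤ -1 := by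
  obtain ⟨d, hd⟩ := exists_rank hC z
  obtain ⟨n, hn⟩ := (Set.finite_range d).bddAbove
  obtain ⟨D, hD⟩ := (Set.finite_range (indeg A)).bddAbove
  have hn' : ∀ i, d i ≤ n := fun i => hn ⟨i, rfl⟩
  have hD' : ∀ i, indeg A i ≤ D := fun i => hD ⟨i, rfl⟩
  let f : V → ℤ := fun i => -((D : ℤ) + 1) ^ (n - d i)
  refine ⟨f - fun _ => f z, by simp, fun i hi => ?_⟩
  rw [lap_sub, lap_const hA, sub_zero]
  obtain ⟨j, hAj, hdj⟩ := hd i hi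
  have hM : (1 : ℤ) ≤ (D : ℤ) + 1 := by simp
  have hpos : (1 : ℤ) ≤ ((D : ℤ) + 1) ^ (n - d i) := one_le_pow₀ hM
  have hfj : f j ≤ -(((D : ℤ) + 1) ^ (n - d i) * ((D : ℤ) + 1)) := by
    rw [← pow_succ]
    refine neg_le_neg (pow_le_pow_right₀ hM ?_)
    have := hn' i
    lia
  have hf : ∀ k, f k ≤ -1 := fun k => neg_le_neg (one_le_pow₀ hM)
  have hdeg : (deg A i : ℤ) ≤ D := by
    rw [deg, hA i]
    exact_mod_cast hD' i
  have hsum : ∑ k, (A k i : ℤ) * f k ≤ f j := by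
    rw [← Finset.add_sum_erase _ _ (Finset.mem_univ j)]
    have h1 : (A j i : ℤ) * f j ≤ f j := by
      have : (1 : ℤ) ≤ A j i := by exact_mod_cast hAj
      nlinarith [hf j]
    have h2 : ∑ k ∈ Finset.univ.erase j, (A k i : ℤ) * f k ≤ 0 :=
      Finset.sum_nonpos fun k _ =>
        mul_nonpos_of_nonneg_of_nonpos (by positivity) (by linarith [hf k])
    linarith
  have hfi : -(deg A i : ℤ) * f i ≤ D * ((D : ℤ) + 1) ^ (n - d i) := by
    have : -(deg A i : ℤ) * f i = deg A i * ((D : ℤ) + 1) ^ (n - d i) := by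
      simp only [f]
      ring
    rw [this]
    exact mul_le_mul_of_nonneg_right hdeg (by linarith)
  rw [lap]
  linarith [mul_add_one (((D : ℤ) + 1) ^ (n - d i)) (D : ℤ),
    mul_comm (((D : ℤ) + 1) ^ (n - d i)) (D : ℤ)]

/-- Minimum principle: a function strictly superharmonic off `z` is minimal at `z`. -/
lemma apply_le_of_lap_neg [Fintype V] [DecidableEq V]
    {A : V → V → ℕ} (hA : Eulerian A) {z : V} {u : V → ℤ}
    (hu : ∀ i, i ≠ z → lap A u i < 0) (i : V) : u z ≤ u i := by
  have : Nonempty V := ⟨z⟩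
  obtain ⟨j, hj⟩ := Finite.exists_min u
  by_cases hjz : j = z
  · exact hjz ▸ hj i
  · exact absurd (lap_nonneg_of_isMin hA hj) (not_le.2 (hu j hjz))

lemma exists_stableOff [Fintype V] [DecidableEq V]
    {A : V → V → ℕ} (hA : Eulerian A) (hC : Connected A) (z : V)
    (s : V → ℤ) : ∃ u : V → ℤ, u z = 0 ∧ (∀ i, 0 ≤ u i) ∧
      StableOff A (fun i => i = z) (s + lap A u) := by
  obtain ⟨h, hz, hh⟩ := exists_lap_le_neg_one hA hC z
  have hpos : ∀ i, 0 ≤ h i := fun i =>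
    hz ▸ apply_le_of_lap_neg hA (fun i hi => by linarith [hh i hi]) i
  obtain ⟨c, hc⟩ := (Set.finite_range s).bddAbove
  refine ⟨(|c| + 1) • h, by simp [hz], fun i => ?_, fun i hi => ?_⟩
  · exact mul_nonneg (by positivity) (hpos i)
  · have h1 : s i ≤ c := hc ⟨i, rfl⟩
    have h2 := mul_le_mul_of_nonneg_left (hh i hi) (show 0 ≤ |c| + 1 by positivity)
    have h3 : (0 : ℤ) ≤ deg A i := by positivity
    rw [lap_smul]
    simp only [Pi.add_apply, Pi.smul_apply, smul_eq_mul]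
    linarith [le_abs_self c]

lemma sinkStabilizable [Fintype V] [DecidableEq V]
    {A : V → V → ℕ} (hA : Eulerian A) (hC : Connected A) (z : V)
    (s : V → ℤ) : StabilizableVia A (fun i => i = z) s :=
  let ⟨_, _, hu, hs⟩ := exists_stableOff hA hC z s
  stabilizableVia_of_stableOff hu hs

/-- Recurrence as minimality: among all topplings of `ρ` that keep it stable off `z`,
none topples a vertex less often than `z`. -/
lemma zRec_iff [Fintype V] [DecidableEq V] {A : V → V → ℕ} (hA : Eulerian A) {z : V} {ρ : V → ℤ} :
    ZRec A z ρ ↔ ρ z = (deg A z : ℤ) ∧ StableOff A (fun i => i = z) ρ ∧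
      ∀ w : V → ℤ, StableOff A (fun i => i = z) (ρ + lap A w) → ∀ i, w z ≤ w i := by
  refine and_congr_right fun _ => and_congr_right fun hst => ⟨?_, ?_⟩
  · rintro ⟨l, ⟨hl, -⟩, hcount⟩ w hw i
    have : Nonempty V := ⟨z⟩
    obtain ⟨j, hj⟩ := Finite.exists_min w
    by_contra! hi
    have hjz : w j < w z := (hj i).trans_lt hi
    let u : V → ℤ := w - fun _ => w j
    have hu : ∀ k, 0 ≤ u k := fun k => sub_nonneg.2 (hj k)
    have huz : 1 ≤ u z := by simp only [u, Pi.sub_apply]; lia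
    have hne : j ≠ z := fun h => by simp [h] at hjz
    have := counts_le_of_stableOff hl (sub_delta_nonneg hu huz) (by
      change StableOff A _ (toppleAt A ρ z + _)
      rwa [toppleAt_add_lap_sub, lap_sub, lap_const hA, sub_zero]) j
    simp [counts, hcount j hne, delta_of_ne hne, u] at this
  · intro H
    have h1 : ∀ i, 0 ≤ ((fun _ => 1 : V → ℤ) - delta z) i :=
      sub_delta_nonneg (fun _ => zero_le_one) le_rfl
    have h2 : StableOff A (fun i => i = z)
        (toppleAt A ρ z + lap A ((fun _ => 1 : V → ℤ) - delta z)) := by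
      rw [toppleAt_add_lap_sub, lap_const hA, add_zero]
      exact hst
    obtain ⟨l, hl, hl'⟩ := stabilizableVia_of_stableOff h1 h2
    refine ⟨l, ⟨hl, hl'⟩, fun i hi => ?_⟩
    have hle := counts_le_of_stableOff hl h1 h2 i
    rw [applySeq_eq, toppleAt_eq, add_assoc, ← lap_add] at hl'
    have hge := H _ hl' i
    have hz := counts_nonneg l z
    simp only [Pi.add_apply, Pi.sub_apply, delta_self, delta_of_ne hi, counts] at hle hge hz
    lia

lemma stableOff_congr [Fintype V] {A : V → V → ℕ} {z : V} {s t : V → ℤ} (h : ∀ i, i ≠ z → s i = t i)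
    (hs : StableOff A (fun i => i = z) s) : StableOff A (fun i => i = z) t :=
  fun i hi => h i hi ▸ hs i hi

lemma exists_zDecomp [Fintype V] [DecidableEq V]
    {A : V → V → ℕ} (hA : Eulerian A) (hC : Connected A) (z : V)
    (s : V → ℤ) : ∃ ρ m v, ZDecomp A z s ρ m v := by
  let P : (V → ℤ) → Prop := fun w => w z = 0 ∧ StableOff A (fun i => i = z) (s + lap A w)
  obtain ⟨u, huz, -, hu⟩ := exists_stableOff hA hC z s
  have hbdd : ∃ b : ℤ, ∀ n : ℤ, (∃ w, P w ∧ ∑ i, w i = n) → b ≤ n := by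
    obtain ⟨h, hz, hh⟩ := exists_lap_le_neg_one hA hC z
    obtain ⟨c, hc⟩ := (Set.finite_range fun i => (deg A i : ℤ) - s i).bddAbove
    refine ⟨∑ i, -((|c| + 1) * h i), ?_⟩
    rintro n ⟨w, ⟨hwz, hw⟩, rfl⟩
    refine Finset.sum_le_sum fun i _ => ?_
    have := apply_le_of_lap_neg hA (z := z) (u := w + (|c| + 1) • h) (fun i hi => by
      have h1 : (deg A i : ℤ) - s i ≤ c := hc ⟨i, rfl⟩
      have h2 := mul_le_mul_of_nonneg_left (hh i hi) (show 0 ≤ |c| + 1 by positivity)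
      have h3 := hw i hi
      rw [lap_add, lap_smul]
      simp only [Pi.add_apply, Pi.smul_apply, smul_eq_mul] at h3 ⊢
      linarith [le_abs_self c]) i
    simp only [Pi.add_apply, Pi.smul_apply, smul_eq_mul, hz, hwz] at this
    linarith
  obtain ⟨b, hb⟩ := hbdd
  obtain ⟨_, ⟨w, ⟨hwz, hw⟩, rfl⟩, hmin⟩ :=
    Int.exists_least_of_bdd ⟨b, hb⟩ ⟨_, u, ⟨huz, hu⟩, rfl⟩
  have hle : ∀ w', StableOff A (fun i => i = z) (s + lap A (w + w')) → ∀ i, w' z ≤ w' i := by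
    intro w' hw' i
    let x : V → ℤ := fun j => min (w j) ((w + w') j - w' z)
    have hx : P x := by
      refine ⟨by simp [x, hwz], fun j hj => ?_⟩
      have hcmp : ∀ y : V → ℤ, x j = y j → (∀ k, x k ≤ y k) → lap A x j ≤ lap A y j := by
        intro y hy hxy
        rw [lap, lap, hy]
        gcongr with k
        exact hxy k
      rcases min_choice (w j) ((w + w') j - w' z) with hj' | hj'
      · have h1 := hcmp w hj' fun k => min_le_left _ _
        have h2 := hw j hj
        simp only [Pi.add_apply] at h2 ⊢
        linarith
      · have h1 := hcmp ((w + w') - fun _ => w' z) hj' fun k => min_le_right _ _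
        rw [lap_sub, lap_const hA, sub_zero] at h1
        have h2 := hw' j hj
        simp only [Pi.add_apply] at h1 h2 ⊢
        linarith
    have hsum := hmin _ ⟨x, hx, rfl⟩
    have hxw : ∀ j ∈ Finset.univ, x j ≤ w j := fun j _ => min_le_left _ _
    have heq := (Finset.sum_eq_sum_iff_of_le hxw).1
      (le_antisymm (Finset.sum_le_sum hxw) hsum) i (Finset.mem_univ i)
    have : x i ≤ (w + w') i - w' z := min_le_right _ _
    simp only [Pi.add_apply] at this
    linarith
  let m : ℤ := (s + lap A w) z - deg A z
  have hoff : ∀ x : V → ℤ, ∀ i, i ≠ z →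
      (s + lap A w - m • delta z + x) i = (s + lap A w + x) i := by
    intro x i hi
    simp [delta_of_ne hi]
  refine ⟨s + lap A w - m • delta z, m, -w, (zRec_iff hA).2 ⟨?_, ?_, ?_⟩, by simp [hwz], ?_⟩
  · simp [delta_self, m]
  · exact stableOff_congr (fun i hi => by simp [delta_of_ne hi]) hw
  · intro w' hw'
    refine hle w' ?_
    rw [lap_add, ← add_assoc]
    exact stableOff_congr (hoff _) hw'
  · intro j
    rw [lap_neg]
    simp

lemma zDecomp_unique [Fintype V] [DecidableEq V]
    {A : V → V → ℕ} (hA : Eulerian A) {z : V} {s ρ ρ' v v' : V → ℤ}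
    {m m' : ℤ} (h : ZDecomp A z s ρ m v) (h' : ZDecomp A z s ρ' m' v') :
    ρ = ρ' ∧ m = m' := by
  have key : ∀ {ρ ρ' v v' : V → ℤ} {m m' : ℤ}, ZDecomp A z s ρ m v →
      ZDecomp A z s ρ' m' v' → ∀ i, v' i ≤ v i := by
    intro ρ ρ' v v' m m' ⟨hρ, hv, hs⟩ ⟨hρ', hv', hs'⟩ i
    have := ((zRec_iff hA).1 hρ).2.2 (v - v') (stableOff_congr (fun j hj => by
      have h1 := hs j
      have h2 := hs' j
      rw [lap_sub]
      simp only [Pi.add_apply, Pi.sub_apply, delta_of_ne hj] at h1 h2 ⊢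
      linarith) ((zRec_iff hA).1 hρ').2.1) i
    simp only [Pi.sub_apply, hv, hv'] at this
    linarith
  have hvv : v = v' := funext fun i => le_antisymm (key h' h i) (key h h' i)
  obtain ⟨hρ, -, hs⟩ := h
  obtain ⟨hρ', -, hs'⟩ := h'
  subst hvv
  have hm : m = m' := by
    have h1 := hs z
    have h2 := hs' z
    rw [hρ.1, delta_self] at h1
    rw [hρ'.1, delta_self] at h2
    linarith
  refine ⟨funext fun i => ?_, hm⟩
  have h1 := hs i
  have h2 := hs' i
  rw [hm] at h1
  linarith

lemma Rz_eq_and_mz_eq [Fintype V] [DecidableEq V]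
    {A : V → V → ℕ} (hA : Eulerian A) {z : V} {s ρ v : V → ℤ}
    {m : ℤ} (h : ZDecomp A z s ρ m v) : Rz A z s = ρ ∧ mz A z s = m := by
  have h1 : ∃ ρ, ∃ m, ∃ v, ZDecomp A z s ρ m v := ⟨ρ, m, v, h⟩
  have h2 : ∃ m, ∃ ρ, ∃ v, ZDecomp A z s ρ m v := ⟨m, ρ, v, h⟩
  rw [Rz, dif_pos h1, mz, dif_pos h2]
  obtain ⟨_, _, e1⟩ := h1.choose_spec
  obtain ⟨_, _, e2⟩ := h2.choose_spec
  exact ⟨(zDecomp_unique hA e1 h).1, (zDecomp_unique hA e2 h).2⟩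

lemma zDecomp_Rz_mz [Fintype V] [DecidableEq V]
    {A : V → V → ℕ} (hA : Eulerian A) (hC : Connected A) (z : V)
    (s : V → ℤ) : ∃ v, ZDecomp A z s (Rz A z s) (mz A z s) v := by
  obtain ⟨ρ, m, v, h⟩ := exists_zDecomp hA hC z s
  obtain ⟨h1, h2⟩ := Rz_eq_and_mz_eq hA h
  exact ⟨v, by rwa [h1, h2]⟩

lemma openAdd_spec [Fintype V] [DecidableEq V]
    {A : V → V → ℕ} (hA : Eulerian A) (hC : Connected A) {z : V} (i : V)
    {ρ : V → ℤ} (hρ : ZRec A z ρ) : ZRec A z (openAdd A z i ρ) ∧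
      ∃ (w : V → ℤ) (c : ℤ), w z = 0 ∧
        openAdd A z i ρ = ρ + delta i + lap A w - c • delta z := by
  obtain ⟨l, hl, hl', hst⟩ := stabilizeVia_spec (sinkStabilizable hA hC z (ρ + delta i))
  have hlz := counts_eq_zero_of_forbidden hl (z := z) rfl
  have heq : openAdd A z i ρ = ρ + delta i + lap A (counts l) -
      ((ρ + delta i + lap A (counts l)) z - (deg A z : ℤ)) • delta z := by
    funext j
    by_cases hj : j = z
    · subst hj
      simp [openAdd, delta_self]
    · have : sinkStabilize A z (fun k => ρ k + delta i k) j =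
        (ρ + delta i + lap A (counts l)) j := congrFun hl' j
      simp [openAdd, hj, this, delta_of_ne hj]
  refine ⟨(zRec_iff hA).2 ⟨by simp [openAdd], ?_, fun w' hw' j => ?_⟩, _, _, hlz, heq⟩
  · rw [heq]
    exact stableOff_congr (fun i hi => by simp [delta_of_ne hi]) hst
  · have h1 : StableOff A (fun i => i = z) (ρ + delta i + lap A (counts l + w')) := by
      refine stableOff_congr (fun k hk => ?_) hw'
      rw [heq, lap_add]
      simp [delta_of_ne hk, add_assoc]
    have h2 := ((zRec_iff hA).1 hρ).2.2 (counts l + w') fun k hk => by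
      have := h1 k hk
      have := delta_nonneg i k
      simp only [Pi.add_apply] at *
      linarith
    have h3 := counts_le_of_stableOff hl (u := counts l + w' - fun _ => w' z) (fun k => by
      have := h2 k
      simp only [Pi.add_apply, Pi.sub_apply, hlz] at *
      linarith) (by rwa [lap_sub, lap_const hA, sub_zero]) j
    simp only [Pi.add_apply, Pi.sub_apply] at h3
    linarith

lemma openAdd_injOn [Fintype V] [DecidableEq V]
    {A : V → V → ℕ} (hA : Eulerian A) (hC : Connected A) {z i : V}
    {ρ ρ' : V → ℤ} (hρ : ZRec A z ρ) (hρ' : ZRec A z ρ')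
    (h : openAdd A z i ρ = openAdd A z i ρ') : ρ = ρ' := by
  obtain ⟨-, w, c, hw, e⟩ := openAdd_spec hA hC i hρ
  obtain ⟨-, w', c', hw', e'⟩ := openAdd_spec hA hC i hρ'
  rw [e, e'] at h
  refine (zDecomp_unique hA (s := ρ) (m := 0) (v := 0) (m' := c - c') (v' := w' - w)
    ⟨hρ, rfl, fun j => by simp [lap_zero]⟩ ⟨hρ', by simp [hw, hw'], fun j => ?_⟩).1
  have := congrFun h j
  rw [lap_sub]
  simp only [Pi.add_apply, Pi.sub_apply, Pi.smul_apply, smul_eq_mul] at this ⊢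
  linarith

lemma openAddInv_openAdd [Fintype V] [DecidableEq V]
    {A : V → V → ℕ} (hA : Eulerian A) (hC : Connected A) {z i : V}
    {ρ : V → ℤ} (hρ : ZRec A z ρ) : openAddInv A z i (openAdd A z i ρ) = ρ := by
  have h : ∃ ρ', ZRec A z ρ' ∧ openAdd A z i ρ' = openAdd A z i ρ := ⟨ρ, hρ, rfl⟩
  rw [openAddInv, dif_pos h]
  exact openAdd_injOn hA hC h.choose_spec.1 hρ h.choose_spec.2

lemma stabilizable_iff_mz_neg [Fintype V] [DecidableEq V]
    {A : V → V → ℕ} (hA : Eulerian A) (hC : Connected A) (z : V)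
    (s : V → ℤ) : Stabilizable A s ↔ mz A z s < 0 := by
  obtain ⟨v, hρ, -, hs⟩ := zDecomp_Rz_mz hA hC z s
  obtain ⟨hz, hst, hmin⟩ := (zRec_iff hA).1 hρ
  rw [stabilizable_iff hA]
  constructor
  · rintro ⟨u, hu⟩
    have h1 := hmin (v + u) fun i hi => by
      have h2 := hu i
      have h3 := hs i
      rw [lap_add]
      simp only [Pi.add_apply, delta_of_ne hi] at h2 h3 ⊢
      linarith
    have h4 := lap_nonneg_of_isMin hA h1
    have h2 := hu z
    have h3 := hs z
    rw [lap_add] at h4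
    simp only [Pi.add_apply, delta_self] at h2 h3 h4
    linarith
  · intro hm
    refine ⟨-v, fun i => ?_⟩
    have h3 := hs i
    rw [lap_neg]
    by_cases hi : i = z
    · subst hi
      simp only [Pi.add_apply, Pi.neg_apply, delta_self] at h3 ⊢
      linarith
    · have h2 := hst i hi
      simp only [Pi.add_apply, Pi.neg_apply, delta_of_ne hi] at h3 ⊢
      linarith

lemma closedAdd_eq [Fintype V] [DecidableEq V] (A : V → V → ℕ) (i : V) (s : V → ℤ) :
    ∃ u, closedAdd A i s = s + delta i + lap A u := by
  unfold closedAdd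
  split_ifs with h
  · obtain ⟨l, -, hl, -⟩ := stabilizeVia_spec h
    exact ⟨_, hl⟩
  · exact ⟨0, by rw [lap_zero, add_zero]; rfl⟩

lemma Rz_mz_closedAdd [Fintype V] [DecidableEq V]
    {A : V → V → ℕ} (hA : Eulerian A) (hC : Connected A) (z i : V)
    (s : V → ℤ) : Rz A z (closedAdd A i s) = openAdd A z i (Rz A z s) ∧
      mz A z (closedAdd A i s) = mz A z s + burst A z i (Rz A z (closedAdd A i s)) := by
  obtain ⟨v, hρ, hv, hs⟩ := zDecomp_Rz_mz hA hC z s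
  obtain ⟨hρ', w, c, hw, e⟩ := openAdd_spec hA hC i hρ
  obtain ⟨u, hu⟩ := closedAdd_eq A i s
  have hdec : ZDecomp A z (closedAdd A i s) (openAdd A z i (Rz A z s)) (mz A z s + c)
      (v + u - w - fun _ => u z) := by
    refine ⟨hρ', by simp [hv, hw], fun j => ?_⟩
    rw [hu, e, lap_sub, lap_const hA, lap_sub, lap_add]
    have := hs j
    simp only [Pi.add_apply, Pi.sub_apply, Pi.smul_apply, smul_eq_mul, Pi.zero_apply]
    linarith
  obtain ⟨h1, h2⟩ := Rz_eq_and_mz_eq hA hdec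
  refine ⟨h1, ?_⟩
  have hd : ∀ x : V, ∑ j, delta x j = 1 := fun x => by simp [delta]
  have hmass : totalMass (openAdd A z i (Rz A z s)) = totalMass (Rz A z s) + 1 - c := by
    rw [e]
    simp only [totalMass, Pi.add_apply, Pi.sub_apply, Pi.smul_apply, smul_eq_mul,
      Finset.sum_add_distrib, Finset.sum_sub_distrib, ← Finset.mul_sum, hd, sum_lap]
    ring
  rw [h2, h1, burst, openAddInv_openAdd hA hC hρ, hmass]
  ring

end ThresholdState

open ThresholdState in
/-- For the closed chain `s_k` with `z`-recurrent decompositions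
`s_k = ρ_k + m_k·δ_z + Δv_k`:
(a) `ρ_k = â_{i_k} ρ_{k-1}`;
(b) `m_k = m_0 + Σ_{j=1}^k av_{i_j→z}(ρ_j)`;
(c) the threshold time `τ = min{k : s_k not stabilizable}` equals
`min{k : m_k ≥ 0}` (stated as: `τ = k` iff `k` is the first index with
`m_k ≥ 0`). -/
theorem statement_14 {V : Type*} [Fintype V] [DecidableEq V]
    (A : V → V → ℕ) (hEul : Eulerian A) (hConn : Connected A)
    (z : V) (idx : ℕ → V) (s : ℕ → V → ℤ)
    (hs : ∀ k : ℕ, s (k + 1) = closedAdd A (idx (k + 1)) (s k)) :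
    (∀ k : ℕ, Rz A z (s (k + 1)) = openAdd A z (idx (k + 1)) (Rz A z (s k))) ∧
    (∀ k : ℕ, mz A z (s k)
        = mz A z (s 0) + ∑ j ∈ Finset.Icc 1 k, burst A z (idx j) (Rz A z (s j))) ∧
    (∀ k : ℕ,
      ((¬ Stabilizable A (s k)) ∧ ∀ j < k, Stabilizable A (s j)) ↔
      ((0 ≤ mz A z (s k)) ∧ ∀ j < k, mz A z (s j) < 0)) := by
  have step : ∀ k, Rz A z (s (k + 1)) = openAdd A z (idx (k + 1)) (Rz A z (s k)) ∧
      mz A z (s (k + 1)) = mz A z (s k) + burst A z (idx (k + 1)) (Rz A z (s (k + 1))) :=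
    fun k => hs k ▸ Rz_mz_closedAdd hEul hConn z (idx (k + 1)) (s k)
  refine ⟨fun k => (step k).1, fun k => ?_, fun k => ?_⟩
  · induction k with
    | zero => simp
    | succ k ih => rw [(step k).2, ih, Finset.sum_Icc_succ_top (by lia), add_assoc]
  · simp only [stabilizable_iff_mz_neg hEul hConn z, not_lt]
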